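/- arXiv:2308.12787 — 3 statements merged into one kernel-verified Lean document; each statement's English description precedes it below -/
import Mathlib

section
/- Let G be a finite simple connected graph on n vertices with n ≥ 2, let Δ be its Laplacian matrix, and let C ∈ ℤ^V be a divisor. Suppose there exists a legal firing sequence from C of length M₀ whose resulting divisor is stable. Then every vector v ∈ ℤ^V such that C − Δ·v is stable satisfies ‖v‖₁ ≥ M₀/(n−1); in other words, the minimal number M_min of single lending or borrowing moves needed to reach a stable divisor from C satisfies M_min ≥ M₀/(n−1). -/
open Matrix Finset

/-- The count vector of a list of vertices: `countVec L x` is the number of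
occurrences of `x` in `L`, viewed as an integer. -/
def countVec {V : Type*} [DecidableEq V] (L : List V) : V → ℤ :=
  fun x => (L.count x : ℤ)

/-- A divisor `D` is stable if every vertex has at most its degree minus one chips. -/
def Stable {V : Type*} [Fintype V] (G : SimpleGraph V) [DecidableRel G.Adj]
    (D : V → ℤ) : Prop :=
  ∀ x, D x ≤ (G.degree x : ℤ) - 1

/-- `L` is a legal firing sequence from the divisor `C`: at each step, the vertex
being fired has at least as many chips as its degree. -/
def LegalSeq {V : Type*} [Fintype V] [DecidableEq V] (G : SimpleGraph V)
    [DecidableRel G.Adj] (C : V → ℤ) (L : List V) : Prop :=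
  ∀ j : Fin L.length,
    (G.degree (L.get j) : ℤ) ≤
      (C - (G.lapMatrix ℤ).mulVec (countVec (L.take j))) (L.get j)

/-- If `u ≤ v` with equality at `x`, then firing `v` leaves at least as many chips at `x`
as firing `u`. -/
lemma lapMatrix_mulVec_apply_le_of_le_of_eq {V : Type*} [Fintype V] [DecidableEq V]
    (G : SimpleGraph V) [DecidableRel G.Adj] {u v : V → ℤ} (huv : u ≤ v) {x : V}
    (hx : u x = v x) : (G.lapMatrix ℤ).mulVec v x ≤ (G.lapMatrix ℤ).mulVec u x := by
  rw [SimpleGraph.lapMatrix_mulVec_apply, SimpleGraph.lapMatrix_mulVec_apply, hx]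
  exact sub_le_sub_left (Finset.sum_le_sum fun y _ => huv y) _

/-- The least action principle: a legal firing sequence fires every vertex at most as often
as any nonnegative firing vector that leads to a stable divisor. -/
lemma LegalSeq.countVec_le {V : Type*} [Fintype V] [DecidableEq V]
    {G : SimpleGraph V} [DecidableRel G.Adj] {C : V → ℤ} {L : List V}
    (hL : LegalSeq G C L) {v : V → ℤ} (hv : 0 ≤ v)
    (hstab : Stable G (C - (G.lapMatrix ℤ).mulVec v)) : countVec L ≤ v := by
  suffices h : ∀ j ≤ L.length, countVec (L.take j) ≤ v by
    simpa using h L.length le_rfl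
  intro j
  induction j with
  | zero => intro _ x; simpa [countVec] using hv x
  | succ j ih =>
    intro hj
    have hle := ih (by omega)
    have hne : countVec (L.take j) L[j] ≠ v L[j] := by
      intro heq
      have hfire := hL ⟨j, hj⟩
      have hs := hstab L[j]
      have hlap := lapMatrix_mulVec_apply_le_of_le_of_eq G hle heq
      simp only [List.get_eq_getElem, Pi.sub_apply] at hfire hs
      linarith
    intro x
    have hx := hle x
    simp only [countVec] at hx hne ⊢
    rw [List.take_succ_eq_append_getElem hj, List.count_append, List.count_singleton]
    by_cases h : L[j] = x
    · subst h
      have := lt_of_le_of_ne hx hne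
      simp only [beq_self_eq_true, if_true]
      push_cast
      omega
    · simpa [h] using hx

/-- The entries of the count vector of a list add up to its length. -/
lemma sum_countVec {V : Type*} [Fintype V] [DecidableEq V] (L : List V) :
    ∑ x, countVec L x = L.length := by
  have h := Multiset.sum_count_eq_card (s := Finset.univ) (m := (L : Multiset V))
    (fun a _ => Finset.mem_univ a)
  simp only [Multiset.coe_count, Multiset.coe_card] at h
  simp only [countVec]
  exact_mod_cast h

/-- Measured from the value at any vertex, the total of an integer vector is at most
`n - 1` times its `ℓ¹` norm. -/
lemma sum_sub_apply_le {V : Type*} [Fintype V] [DecidableEq V]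
    (hn : 2 ≤ Fintype.card V) (v : V → ℤ) (a : V) :
    ∑ x, (v x - v a) ≤ ((Fintype.card V : ℤ) - 1) * ∑ x, |v x| := by
  have hcard : ((Finset.univ.erase a).card : ℤ) = (Fintype.card V : ℤ) - 1 := by
    rw [Finset.card_erase_of_mem (Finset.mem_univ a), Finset.card_univ]
    omega
  have hpos : 0 ≤ ∑ x ∈ Finset.univ.erase a, |v x| :=
    Finset.sum_nonneg fun x _ => abs_nonneg (v x)
  have hn' : (2 : ℤ) ≤ Fintype.card V := by exact_mod_cast hn
  rw [← Finset.add_sum_erase _ _ (Finset.mem_univ a),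
    ← Finset.add_sum_erase _ (fun x => |v x|) (Finset.mem_univ a)]
  calc v a - v a + ∑ x ∈ Finset.univ.erase a, (v x - v a)
      ≤ ∑ x ∈ Finset.univ.erase a, (|v x| + |v a|) := by
        rw [sub_self, zero_add]
        exact Finset.sum_le_sum fun x _ =>
          (le_abs_self _).trans (abs_sub (v x) (v a))
    _ = ∑ x ∈ Finset.univ.erase a, |v x| + ((Fintype.card V : ℤ) - 1) * |v a| := by
        rw [Finset.sum_add_distrib, Finset.sum_const, nsmul_eq_mul, hcard]
    _ ≤ _ := by nlinarith

/-- Main theorem: if the greedy (borrowing binge) strategy uses `M₀` moves, then any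
way of reaching a stable divisor (using lending and borrowing moves) needs at least
`M₀ / (n - 1)` moves. -/
theorem min_moves_ge_binge_div_card_sub_one {V : Type*} [Fintype V] [DecidableEq V]
    (G : SimpleGraph V) [DecidableRel G.Adj]
    (hG : G.Connected) (hn : 2 ≤ Fintype.card V)
    (C : V → ℤ) (L : List V)
    (hL : LegalSeq G C L)
    (hstab : Stable G (C - (G.lapMatrix ℤ).mulVec (countVec L))) :
    ∀ v : V → ℤ, Stable G (C - (G.lapMatrix ℤ).mulVec v) →
      (L.length : ℚ) / ((Fintype.card V : ℚ) - 1) ≤ ((∑ x, |v x| : ℤ) : ℚ) := by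
  intro v hv
  have : Nonempty V := hG.nonempty
  obtain ⟨a, ha⟩ := Finite.exists_min v
  have hshift : (G.lapMatrix ℤ).mulVec (fun x => v x - v a) = (G.lapMatrix ℤ).mulVec v := by
    ext x
    simp only [SimpleGraph.lapMatrix_mulVec_apply, Finset.sum_sub_distrib, Finset.sum_const,
      SimpleGraph.card_neighborFinset_eq_degree, nsmul_eq_mul]
    ring
  have hle : countVec L ≤ fun x => v x - v a :=
    hL.countVec_le (fun x => sub_nonneg.2 (ha x)) (hshift ▸ hv)
  have hmain : (L.length : ℤ) ≤ ((Fintype.card V : ℤ) - 1) * ∑ x, |v x| :=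
    (sum_countVec L).symm.le.trans
      ((Finset.sum_le_sum fun x _ => hle x).trans (sum_sub_apply_le hn v a))
  have hn' : (2 : ℚ) ≤ Fintype.card V := by exact_mod_cast hn
  rw [div_le_iff₀' (by linarith)]
  exact_mod_cast hmain
end

section
/- (Least action principle.) Let G be a finite simple graph with Laplacian Δ and let C ∈ ℤ^V be a divisor. Let x₁,…,x_M be a legal firing sequence from C whose resulting divisor is stable, and let v₀ ∈ ℕ^V be its count vector. Then for every vector v₁ ∈ ℤ^V with v₁ ≥ 0 (componentwise) such that C − Δ·v₁ is stable, one has v₁ ≥ v₀ componentwise. -/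
open Matrix Finset

/-- If `w ≤ v` with equality at `x`, then the Laplacian of `v` is at most that of `w` at `x`. -/
theorem lapMatrix_mulVec_le_of_le_of_eq {V : Type*} [Fintype V] [DecidableEq V]
    (G : SimpleGraph V) [DecidableRel G.Adj] {w v : V → ℤ} (h : w ≤ v) {x : V} (hx : w x = v x) :
    (G.lapMatrix ℤ).mulVec v x ≤ (G.lapMatrix ℤ).mulVec w x := by
  rw [SimpleGraph.lapMatrix_mulVec_apply, SimpleGraph.lapMatrix_mulVec_apply, hx]
  exact sub_le_sub_left (Finset.sum_le_sum fun y _ => h y) _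

/-- Counts in prefixes of a legal firing sequence are bounded by any nonnegative stabilizing
vector. -/
theorem LegalSeq.countVec_take_le {V : Type*} [Fintype V] [DecidableEq V]
    {G : SimpleGraph V} [DecidableRel G.Adj] {C : V → ℤ} {L : List V} (hL : LegalSeq G C L)
    {v : V → ℤ} (hv : 0 ≤ v) (hs : Stable G (C - (G.lapMatrix ℤ).mulVec v)) :
    ∀ n ≤ L.length, countVec (L.take n) ≤ v := by
  intro n
  induction n with
  | zero => intro _ x; simpa [countVec] using hv x
  | succ n ih =>
    intro hn
    have hw := ih (by omega)
    have hne : countVec (L.take n) L[n] ≠ v L[n] := by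
      intro he
      have h1 := lapMatrix_mulVec_le_of_le_of_eq G hw he
      have h2 := hL ⟨n, hn⟩
      have h3 := hs L[n]
      simp only [List.get_eq_getElem, Pi.sub_apply] at h2 h3
      linarith
    intro x
    have hx := hw x
    rw [List.take_succ_eq_append_getElem hn]
    by_cases hxn : L[n] = x
    · subst hxn
      have := lt_of_le_of_ne hx hne
      simp only [countVec, List.count_append, List.count_singleton_self] at this ⊢
      push_cast
      omega
    · have h0 : List.count x [L[n]] = 0 := by simp [hxn]
      simpa only [countVec, List.count_append, h0, add_zero] using hx

/-- Least action principle: if `L` is a legal firing sequence from `C` reaching a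
stable divisor, with count vector `v₀`, then any nonnegative firing vector `v₁`
reaching a stable divisor from `C` satisfies `v₀ ≤ v₁` componentwise. -/
theorem least_action_principle {V : Type*} [Fintype V] [DecidableEq V]
    (G : SimpleGraph V) [DecidableRel G.Adj]
    (C : V → ℤ) (L : List V)
    (hL : LegalSeq G C L)
    (hstab : Stable G (C - (G.lapMatrix ℤ).mulVec (countVec L))) :
    ∀ v₁ : V → ℤ, 0 ≤ v₁ → Stable G (C - (G.lapMatrix ℤ).mulVec v₁) →
      countVec L ≤ v₁ := by
  intro v₁ hv hs
  simpa using hL.countVec_take_le hv hs L.length le_rfl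
end

section
/- Let n ≥ 2 and let v ∈ ℤⁿ satisfy v ≥ 0 componentwise and have at least one coordinate equal to 0. Then for every integer t, ‖v − t·𝟙‖₁ ≥ ‖v‖₁/(n−1), where 𝟙 = (1,…,1). Consequently, if Δ is the Laplacian of a connected simple graph on n vertices and v fires C to X (i.e. X = C − Δ·v), then any vector v' with C − Δ·v' = X satisfies ‖v'‖₁ ≥ ‖v‖₁/(n−1). -/
open Matrix Finset

theorem sum_abs_le_mul_sum_abs_sub {ι : Type*} [Fintype ι] [DecidableEq ι]
    (hι : 2 ≤ Fintype.card ι) (v : ι → ℤ) (h0 : ∃ i, v i = 0) (t : ℤ) :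
    ∑ i, |v i| ≤ ((Fintype.card ι : ℤ) - 1) * ∑ i, |v i - t| := by
  obtain ⟨j, hj⟩ := h0
  have hcard : ((univ.erase j).card : ℤ) = (Fintype.card ι : ℤ) - 1 := by
    rw [card_erase_of_mem (mem_univ j), card_univ, Nat.cast_sub (by omega), Nat.cast_one]
  have hsum : ∑ i ∈ univ.erase j, |v i|
      ≤ ∑ i ∈ univ.erase j, |v i - t| + ((Fintype.card ι : ℤ) - 1) * |t| := by
    rw [← hcard, ← nsmul_eq_mul, ← sum_const, ← sum_add_distrib]
    refine sum_le_sum fun i _ => ?_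
    simpa using abs_add_le (v i - t) t
  have hnonneg : 0 ≤ ∑ i ∈ univ.erase j, |v i - t| := sum_nonneg fun i _ => abs_nonneg _
  have hn : (2 : ℤ) ≤ Fintype.card ι := by exact_mod_cast hι
  rw [← add_sum_erase univ (fun i => |v i|) (mem_univ j),
    ← add_sum_erase univ (fun i => |v i - t|) (mem_univ j)]
  simp only [hj, abs_zero, zero_sub, abs_neg]
  nlinarith

theorem SimpleGraph.Connected.exists_eq_of_lapMatrix_mulVec_eq_zero {V : Type*} [Fintype V]
    [DecidableEq V] {G : SimpleGraph V} [DecidableRel G.Adj] (hG : G.Connected) {x : V → ℤ}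
    (hx : G.lapMatrix ℤ *ᵥ x = 0) : ∃ c, ∀ i, x i = c := by
  have hreal : G.lapMatrix ℝ *ᵥ (fun i => (x i : ℝ)) = 0 := by
    ext i
    have hi := congrArg (Int.cast : ℤ → ℝ) (congrFun hx i)
    rw [G.lapMatrix_mulVec_apply] at hi ⊢
    simpa using hi
  rw [G.lapMatrix_mulVec_eq_zero_iff_forall_reachable] at hreal
  obtain ⟨j⟩ := hG.nonempty
  exact ⟨x j, fun i => by exact_mod_cast hreal i j (hG.preconnected i j)⟩

/-- If `v ∈ ℤⁿ` is nonnegative with a zero coordinate, then every translate of `v`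
by a multiple of the all-ones vector has ℓ¹ norm at least `‖v‖₁ / (n - 1)`;
consequently, any firing vector reaching the same divisor as `v` (for a connected
simple graph on `n` vertices) has ℓ¹ norm at least `‖v‖₁ / (n - 1)`. -/
theorem l1_coset_lower_bound (n : ℕ) (hn : 2 ≤ n) (v : Fin n → ℤ)
    (hv : 0 ≤ v) (h0 : ∃ i, v i = 0) :
    (∀ t : ℤ, ((∑ i, |v i| : ℤ) : ℚ) / ((n : ℚ) - 1) ≤ ((∑ i, |v i - t| : ℤ) : ℚ)) ∧
    (∀ (G : SimpleGraph (Fin n)) (_ : DecidableRel G.Adj), G.Connected →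
      ∀ (C : Fin n → ℤ) (v' : Fin n → ℤ),
        C - (G.lapMatrix ℤ).mulVec v' = C - (G.lapMatrix ℤ).mulVec v →
        ((∑ i, |v i| : ℤ) : ℚ) / ((n : ℚ) - 1) ≤ ((∑ i, |v' i| : ℤ) : ℚ)) := by
  have hbound : ∀ t : ℤ,
      ((∑ i, |v i| : ℤ) : ℚ) / ((n : ℚ) - 1) ≤ ((∑ i, |v i - t| : ℤ) : ℚ) := by
    intro t
    have hn' : (2 : ℚ) ≤ n := by exact_mod_cast hn
    rw [div_le_iff₀' (by linarith)]
    have h := sum_abs_le_mul_sum_abs_sub (by simpa using hn) v h0 t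
    rw [Fintype.card_fin] at h
    exact_mod_cast h
  refine ⟨hbound, fun G _ hG C v' h => ?_⟩
  have hker : G.lapMatrix ℤ *ᵥ (v - v') = 0 := by
    rw [mulVec_sub, sub_eq_zero]
    exact (sub_right_injective h).symm
  obtain ⟨t, ht⟩ := hG.exists_eq_of_lapMatrix_mulVec_eq_zero hker
  have hv' : v' = fun i => v i - t := by
    ext i
    rw [← ht i, Pi.sub_apply, sub_sub_cancel]
  rw [hv']
  exact hbound t
end
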